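/- Assume the Riemann hypothesis (every nontrivial zero of ζ has real part 1/2). Then there exists a constant C > 0 such that every nontrivial zero ρ of the Riemann zeta function with Im ρ ≥ 16 has order of vanishing m(ρ) ≤ C · log(Im ρ) / log log(Im ρ). -/

import Mathlib

open Complex Filter Topology Metric

lemma norm_cpow_neg_sub_cpow_neg_le {a x : ℝ} (ha : 0 < a) (hax : a ≤ x) {s : ℂ}
    (hs : 0 < s.re) :
    ‖(x : ℂ) ^ (-s) - (a : ℂ) ^ (-s)‖ ≤ ‖s‖ * a ^ (-s.re - 1) * (x - a) := by
  have hs0 : -s ≠ 0 := neg_ne_zero.mpr fun h => by simp [h] at hs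
  have key := Convex.norm_image_sub_le_of_norm_hasDerivWithin_le (𝕜 := ℝ) (s := Set.Ici a)
    (f := fun y : ℝ => (y : ℂ) ^ (-s)) (f' := fun y : ℝ => -s * (y : ℂ) ^ (-s - 1))
    (C := ‖s‖ * a ^ (-s.re - 1)) (x := a) (y := x)
    (fun y hy => (hasDerivAt_ofReal_cpow_const
      (ha.trans_le (Set.mem_Ici.mp hy)).ne' hs0).hasDerivWithinAt)
    (fun y hy => ?_) (convex_Ici a) Set.self_mem_Ici hax
  · simpa [Real.norm_eq_abs, abs_of_nonneg (sub_nonneg.mpr hax)] using key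
  · have hy0 : 0 < y := ha.trans_le hy
    rw [norm_mul, norm_neg, norm_cpow_eq_rpow_re_of_pos hy0]
    simp only [sub_re, neg_re, one_re]
    gcongr ?_ * ?_
    exact Real.rpow_le_rpow_of_nonpos ha hy (by linarith)

lemma norm_zeta_summand_le {a : ℝ} (ha : 0 < a) {s : ℂ} (hs : 0 < s.re) :
    ‖(s - 1) * (a : ℂ) ^ (-s) + ((a + 1 : ℝ) : ℂ) ^ (1 - s) - (a : ℂ) ^ (1 - s)‖
      ≤ ‖s - 1‖ * ‖s‖ * a ^ (-s.re - 1) := by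
  rcases eq_or_ne s 1 with rfl | hs1
  · simp
  have h1s : 1 - s ≠ 0 := sub_ne_zero.mpr hs1.symm
  have key := Convex.norm_image_sub_le_of_norm_hasDerivWithin_le (𝕜 := ℝ)
    (s := Set.Icc a (a + 1))
    (f := fun y : ℝ => (y : ℂ) ^ (1 - s) + (s - 1) * (a : ℂ) ^ (-s) * y)
    (f' := fun y : ℝ => (1 - s) * (y : ℂ) ^ (1 - s - 1) + (s - 1) * (a : ℂ) ^ (-s) * 1)
    (C := ‖s - 1‖ * ‖s‖ * a ^ (-s.re - 1)) (x := a) (y := a + 1)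
    (fun y hy => ((hasDerivAt_ofReal_cpow_const (ha.trans_le hy.1).ne' h1s).add
      (ofRealCLM.hasDerivAt.const_mul _)).hasDerivWithinAt)
    (fun y hy => ?_) (convex_Icc _ _) (by simp) (by simp)
  · rw [add_sub_cancel_left, norm_one, mul_one] at key
    refine le_of_eq_of_le (congrArg norm ?_) key
    rw [ofReal_add, ofReal_one]
    ring
  · have e : (1 - s) * (y : ℂ) ^ (1 - s - 1) + (s - 1) * (a : ℂ) ^ (-s) * 1
        = -(s - 1) * ((y : ℂ) ^ (-s) - (a : ℂ) ^ (-s)) := by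
      rw [show 1 - s - 1 = -s by ring]; ring
    rw [e, norm_mul, norm_neg, mul_assoc]
    gcongr
    refine (norm_cpow_neg_sub_cpow_neg_le ha hy.1 hs).trans ?_
    have : y - a ≤ 1 := by linarith [hy.2]
    exact mul_le_of_le_one_right (by positivity) this

/-- The `n`-th term of the series for `(s - 1) ζ(s) - 1`, convergent for `0 < re s`. -/
noncomputable def zetaSummand (n : ℕ) (s : ℂ) : ℂ :=
  (s - 1) * ((n + 1 : ℝ) : ℂ) ^ (-s) + ((n + 1 + 1 : ℝ) : ℂ) ^ (1 - s)
    - ((n + 1 : ℝ) : ℂ) ^ (1 - s)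

lemma differentiable_zetaSummand (n : ℕ) : Differentiable ℂ (zetaSummand n) := by
  have h1 : ((n + 1 : ℝ) : ℂ) ≠ 0 := ofReal_ne_zero.mpr (by positivity)
  have h2 : ((n + 1 + 1 : ℝ) : ℂ) ≠ 0 := ofReal_ne_zero.mpr (by positivity)
  intro s
  unfold zetaSummand
  exact (((differentiableAt_id.sub_const 1).mul
    (differentiableAt_id.neg.const_cpow (Or.inl h1))).add
    ((differentiableAt_id.const_sub 1).const_cpow (Or.inl h2))).sub
    ((differentiableAt_id.const_sub 1).const_cpow (Or.inl h1))

lemma summable_nat_add_one_rpow {p : ℝ} (hp : p < -1) :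
    Summable fun n : ℕ => ((n : ℝ) + 1) ^ p := by
  simpa using (summable_nat_add_iff 1).mpr (Real.summable_nat_rpow (p := p) |>.mpr hp)

lemma hasSum_zetaSummand_of_one_lt_re {s : ℂ} (hs : 1 < s.re) :
    HasSum (fun n => zetaSummand n s) ((s - 1) * riemannZeta s - 1) := by
  have hz : HasSum (fun n : ℕ => (s - 1) * ((n + 1 : ℝ) : ℂ) ^ (-s))
      ((s - 1) * riemannZeta s) := by
    refine HasSum.mul_left _ ?_
    rw [zeta_eq_tsum_one_div_nat_add_one_cpow hs]
    have : Summable fun n : ℕ => 1 / ((n : ℂ) + 1) ^ s := by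
      simpa using (summable_nat_add_iff 1).mpr (Complex.summable_one_div_nat_cpow.mpr hs)
    refine this.hasSum.congr_fun fun n => ?_
    simp [cpow_neg]
  have ht : Tendsto (fun n : ℕ => ((n + 1 : ℝ) : ℂ) ^ (1 - s)) atTop (𝓝 0) := by
    rw [tendsto_zero_iff_norm_tendsto_zero]
    have h := (tendsto_rpow_neg_atTop (y := s.re - 1) (by linarith)).comp
      (tendsto_atTop_add_const_right atTop (1 : ℝ) tendsto_natCast_atTop_atTop)
    refine h.congr fun n => ?_
    rw [norm_cpow_eq_rpow_re_of_pos (by positivity)]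
    simp
  have hsum : Summable fun n : ℕ => zetaSummand n s := by
    refine Summable.of_norm_bounded
      (g := fun n : ℕ => ‖s - 1‖ * ‖s‖ * ((n + 1 : ℝ)) ^ (-s.re - 1)) ?_
      fun n => norm_zeta_summand_le (by positivity) (by linarith)
    exact (summable_nat_add_one_rpow (by linarith)).mul_left _
  have hd : HasSum (fun n : ℕ => ((n + 1 + 1 : ℝ) : ℂ) ^ (1 - s) - ((n + 1 : ℝ) : ℂ) ^ (1 - s))
      (0 - 1) := by
    have hs' : Summable fun n : ℕ =>
        ((n + 1 + 1 : ℝ) : ℂ) ^ (1 - s) - ((n + 1 : ℝ) : ℂ) ^ (1 - s) := by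
      refine (hsum.sub hz.summable).congr fun n => ?_
      simp only [zetaSummand]; ring
    rw [hs'.hasSum_iff_tendsto_nat]
    have e : ∀ N : ℕ, ∑ n ∈ Finset.range N,
        (((n + 1 + 1 : ℝ) : ℂ) ^ (1 - s) - ((n + 1 : ℝ) : ℂ) ^ (1 - s))
        = ((N + 1 : ℝ) : ℂ) ^ (1 - s) - 1 := by
      intro N
      have := Finset.sum_range_sub (fun n : ℕ => ((n + 1 : ℝ) : ℂ) ^ (1 - s)) N
      simpa using this
    simp_rw [e]
    exact ht.sub_const 1
  convert hz.add hd using 1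
  · ext n; simp only [zetaSummand]; ring
  · ring

lemma norm_zetaSummand_le_of_re_ge {δ : ℝ} (hδ : 0 < δ) {s : ℂ} (hs : δ ≤ s.re) (n : ℕ) :
    ‖zetaSummand n s‖ ≤ ‖s - 1‖ * ‖s‖ * ((n : ℝ) + 1) ^ (-δ - 1) := by
  refine (norm_zeta_summand_le (by positivity) (hδ.trans_le hs)).trans ?_
  gcongr
  linarith [(n.cast_nonneg : (0 : ℝ) ≤ n)]

lemma sub_one_mul_riemannZeta_eq_tsum {s : ℂ} (hs : 0 < s.re) (hs1 : s ≠ 1) :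
    (s - 1) * riemannZeta s = 1 + ∑' n, zetaSummand n s := by
  have hU : IsOpen {w : ℂ | 0 < w.re} := isOpen_lt continuous_const continuous_re
  have hdiff : DifferentiableOn ℂ (fun w => 1 + ∑' n, zetaSummand n w) {w : ℂ | 0 < w.re} := by
    intro w hw
    have hw : 0 < w.re := hw
    set V : Set ℂ := {v | w.re / 2 < v.re} ∩ ball 0 (‖w‖ + 1) with hV
    have hVo : IsOpen V := (isOpen_lt continuous_const continuous_re).inter isOpen_ball
    have hwV : w ∈ V := ⟨by simp; linarith, by simp⟩
    have := differentiableOn_tsum_of_summable_norm (F := zetaSummand) (U := V)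
      (u := fun n : ℕ => (‖w‖ + 1 + 1) * (‖w‖ + 1) * ((n : ℝ) + 1) ^ (-(w.re / 2) - 1))
      ((summable_nat_add_one_rpow (by linarith)).mul_left _)
      (fun n => (differentiable_zetaSummand n).differentiableOn) hVo (fun n v hv => by
        refine (norm_zetaSummand_le_of_re_ge (half_pos hw) hv.1.le n).trans ?_
        have h2 : ‖v‖ ≤ ‖w‖ + 1 := (mem_ball_zero_iff.mp hv.2).le
        have h3 : ‖v - 1‖ ≤ ‖w‖ + 1 + 1 := by
          refine (norm_sub_le _ _).trans ?_
          simpa using h2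
        gcongr)
    exact ((this.differentiableAt (hVo.mem_nhds hwV)).const_add 1).differentiableWithinAt
  have heq : Set.EqOn riemannZeta₁ (fun w => 1 + ∑' n, zetaSummand n w) {w : ℂ | 0 < w.re} := by
    refine AnalyticOnNhd.eqOn_of_preconnected_of_eventuallyEq (z₀ := 2)
      (differentiable_riemannZeta₁.differentiableOn.analyticOnNhd hU) (hdiff.analyticOnNhd hU)
      (convex_halfSpace_re_gt 0).isPreconnected (by simp) ?_
    have h2 : {w : ℂ | 1 < w.re} ∈ 𝓝 (2 : ℂ) :=
      (isOpen_lt continuous_const continuous_re).mem_nhds (by simp)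
    filter_upwards [h2] with w hw
    have hw1 : w ≠ 1 := fun h => by simp [h] at hw
    rw [(hasSum_zetaSummand_of_one_lt_re hw).tsum_eq, riemannZeta_eq_inv_sub_mul hw1,
      mul_inv_cancel_left₀ (sub_ne_zero.mpr hw1)]
    ring
  rw [riemannZeta_eq_inv_sub_mul hs1, mul_inv_cancel_left₀ (sub_ne_zero.mpr hs1)]
  exact heq hs

/-- Linear growth of `ζ` in vertical strips to the right of the line `re s = δ`. -/
lemma exists_norm_riemannZeta_le {δ : ℝ} (hδ : 0 < δ) :
    ∃ C : ℝ, 0 < C ∧ ∀ s : ℂ, δ ≤ s.re → 1 ≤ ‖s - 1‖ → ‖riemannZeta s‖ ≤ 1 + C * ‖s‖ := by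
  have hsum : Summable fun n : ℕ => ((n : ℝ) + 1) ^ (-δ - 1) :=
    summable_nat_add_one_rpow (by linarith)
  refine ⟨∑' n : ℕ, ((n : ℝ) + 1) ^ (-δ - 1),
    hsum.tsum_pos (fun n => by positivity) 0 (by simp), fun s hs hs1 => ?_⟩
  have hpos : 0 < ‖s - 1‖ := by linarith
  have h1 : ‖∑' n, zetaSummand n s‖ ≤ ‖s - 1‖ * ‖s‖ * ∑' n : ℕ, ((n : ℝ) + 1) ^ (-δ - 1) :=
    tsum_of_norm_bounded (hsum.hasSum.mul_left _)
      fun n => norm_zetaSummand_le_of_re_ge hδ hs n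
  have h2 := congrArg norm (sub_one_mul_riemannZeta_eq_tsum (hδ.trans_le hs)
    (sub_ne_zero.mp (norm_pos_iff.mp hpos)))
  rw [norm_mul] at h2
  have h3 := norm_add_le (1 : ℂ) (∑' n, zetaSummand n s)
  rw [norm_one] at h3
  refine le_of_mul_le_mul_left ?_ hpos
  nlinarith

/-- The Fejér sums written through partial geometric sums. -/
lemma fejer_sum_eq (w : ℂ) (N : ℕ) :
    ∑ M ∈ Finset.range N, (1 + 2 * (∑ n ∈ Finset.range M, w ^ (n + 1)).re)
      = ‖∑ j ∈ Finset.range N, w ^ j‖ ^ 2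
        + (1 - ‖w‖ ^ 2) * ∑ M ∈ Finset.range N, ‖∑ j ∈ Finset.range M, w ^ j‖ ^ 2 := by
  induction N with
  | zero => simp
  | succ N ih =>
    rw [Finset.sum_range_succ, ih, Finset.sum_range_succ (fun M => ‖_‖ ^ 2),
      Finset.sum_range_succ']
    have e : ∑ n ∈ Finset.range N, w ^ (n + 1) = w * ∑ j ∈ Finset.range N, w ^ j := by
      rw [Finset.mul_sum]
      exact Finset.sum_congr rfl fun n _ => by ring
    rw [e]
    generalize ∑ j ∈ Finset.range N, w ^ j = g
    have h1 : ‖w * g + w ^ 0‖ ^ 2 = ‖w‖ ^ 2 * ‖g‖ ^ 2 + 2 * (w * g).re + 1 := by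
      rw [← mul_pow, ← norm_mul, Complex.sq_norm, Complex.sq_norm, normSq_add]
      simp
      ring
    rw [h1]
    ring

lemma fejer_sum_nonneg {w : ℂ} (hw : ‖w‖ ≤ 1) (N : ℕ) :
    0 ≤ ∑ M ∈ Finset.range N, (1 + 2 * (∑ n ∈ Finset.range M, w ^ (n + 1)).re) := by
  rw [fejer_sum_eq]
  have : 0 ≤ 1 - ‖w‖ ^ 2 := sub_nonneg.mpr (pow_le_one₀ (norm_nonneg w) hw)
  positivity

lemma fejer_sum_one (N : ℕ) :
    ∑ M ∈ Finset.range N, (1 + 2 * (∑ n ∈ Finset.range M, (1 : ℂ) ^ (n + 1)).re) = (N : ℝ) ^ 2 := by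
  rw [fejer_sum_eq]
  simp

/-- If points of the closed unit disc have small power sums, few of them can be equal to `1`. -/
lemma card_mul_le_of_power_sums {ι κ : Type*} [Fintype ι] [Fintype κ] {v : ι ⊕ κ → ℂ}
    (h_one : ∀ i, v (Sum.inl i) = 1) (h_norm : ∀ j, ‖v (Sum.inr j)‖ ≤ 1) {N : ℕ} (hN : 0 < N) :
    (Fintype.card ι : ℝ) * N ≤
      Fintype.card (ι ⊕ κ) + 2 * ∑ n ∈ Finset.range N, ‖∑ i, v i ^ (n + 1)‖ := by
  set P : ℂ → ℝ := fun w =>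
    ∑ M ∈ Finset.range N, (1 + 2 * (∑ n ∈ Finset.range M, w ^ (n + 1)).re) with hP
  have h1 : (Fintype.card ι : ℝ) * N ^ 2 ≤ ∑ i, P (v i) := by
    rw [Fintype.sum_sum_type]
    have : 0 ≤ ∑ j, P (v (Sum.inr j)) :=
      Finset.sum_nonneg fun j _ => fejer_sum_nonneg (h_norm j) N
    simp only [h_one]
    rw [show P 1 = (N : ℝ) ^ 2 from fejer_sum_one N]
    simpa using this
  have h2 : ∑ i, P (v i) ≤
      N * (Fintype.card (ι ⊕ κ) + 2 * ∑ n ∈ Finset.range N, ‖∑ i, v i ^ (n + 1)‖) := by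
    rw [hP, Finset.sum_comm]
    refine (Finset.sum_le_card_nsmul _ _
      (Fintype.card (ι ⊕ κ) + 2 * ∑ n ∈ Finset.range N, ‖∑ i, v i ^ (n + 1)‖)
      fun M hM => ?_).trans_eq (by rw [Finset.card_range, nsmul_eq_mul])
    rw [Finset.sum_add_distrib, ← Finset.mul_sum, ← re_sum, Finset.sum_comm]
    have h3 : (∑ n ∈ Finset.range M, ∑ i, v i ^ (n + 1)).re
        ≤ ∑ n ∈ Finset.range N, ‖∑ i, v i ^ (n + 1)‖ :=
      (re_le_norm _).trans <| (norm_sum_le _ _).trans <|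
        Finset.sum_le_sum_of_subset_of_nonneg
          (Finset.range_subset_range.mpr (Finset.mem_range.mp hM).le) fun _ _ _ => norm_nonneg _
    simp only [Finset.sum_const, Finset.card_univ, nsmul_eq_mul, mul_one]
    linarith
  have hN' : (0 : ℝ) < N := Nat.cast_pos.mpr hN
  refine le_of_mul_le_mul_left ?_ hN'
  nlinarith

/-- A holomorphic function vanishing at `a` is divisible by `z - a`. -/
theorem exists_eq_sub_mul_of_eq_zero {f : ℂ → ℂ} {U : Set ℂ} (hU : IsOpen U)
    (hf : DifferentiableOn ℂ f U) {a : ℂ} (ha : a ∈ U) (h : f a = 0) :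
    ∃ g : ℂ → ℂ, DifferentiableOn ℂ g U ∧ ∀ z, f z = (z - a) * g z := by
  refine ⟨dslope f a, (Complex.differentiableOn_dslope (hU.mem_nhds ha)).2 hf, fun z => ?_⟩
  have := sub_smul_dslope f a z
  rw [h, sub_zero, smul_eq_mul] at this
  exact this.symm

/-- A holomorphic function of order at least `m` at `a` is divisible by `(z - a) ^ m`. -/
theorem exists_eq_sub_pow_mul_of_le_analyticOrderAt {U : Set ℂ} (hU : IsOpen U) {a : ℂ}
    (ha : a ∈ U) (m : ℕ) {f : ℂ → ℂ} (hf : DifferentiableOn ℂ f U)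
    (hm : (m : ℕ∞) ≤ analyticOrderAt f a) :
    ∃ g : ℂ → ℂ, DifferentiableOn ℂ g U ∧ ∀ z, f z = (z - a) ^ m * g z := by
  induction m generalizing f with
  | zero => exact ⟨f, hf, fun z => by simp⟩
  | succ m ih =>
    have hfa : AnalyticAt ℂ f a := hf.analyticAt (hU.mem_nhds ha)
    have h0 : f a = 0 := by
      by_contra h
      rw [hfa.analyticOrderAt_eq_zero.2 h] at hm
      simp at hm
    obtain ⟨g, hg, hfg⟩ := exists_eq_sub_mul_of_eq_zero hU hf ha h0
    have hga : AnalyticAt ℂ g a := hg.analyticAt (hU.mem_nhds ha)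
    have hid : AnalyticAt ℂ (fun z : ℂ => z - a) a := by fun_prop
    have hord : analyticOrderAt (fun z : ℂ => z - a) a = 1 := by
      have := (hid.analyticOrderAt_eq_natCast (n := 1)).2
        ⟨fun _ => 1, analyticAt_const, one_ne_zero, Eventually.of_forall fun z => by simp⟩
      exact_mod_cast this
    have hfg' : f = (fun z : ℂ => z - a) * g := funext hfg
    rw [hfg', analyticOrderAt_mul hid hga, hord] at hm
    have hm' : (m : ℕ∞) ≤ analyticOrderAt g a := by
      rw [Nat.cast_add, Nat.cast_one, add_comm] at hm
      exact (ENat.add_le_add_iff_left (by simp)).1 hm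
    obtain ⟨q, hq, hgq⟩ := ih hg hm'
    exact ⟨q, hq, fun z => by rw [hfg, hgq]; ring⟩

/-- On the circle of radius `R`, the factor `z - a` and its reflection have the same norm. -/
theorem norm_reflected_sub {R : ℝ} (hR : 0 < R) {a z : ℂ} (hz : ‖z‖ = R) :
    ‖(R : ℂ) - (starRingEnd ℂ a / R) * z‖ = ‖z - a‖ := by
  have hR' : (R : ℂ) ≠ 0 := by exact_mod_cast hR.ne'
  have hzz : z * starRingEnd ℂ z = (R : ℂ) ^ 2 := by rw [Complex.mul_conj']; rw [hz]
  have : (R : ℂ) - (starRingEnd ℂ a / R) * z = z / R * starRingEnd ℂ (z - a) := by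
    rw [map_sub]
    field_simp
    rw [mul_sub, hzz]; ring
  rw [this, norm_mul, norm_div, hz, Complex.norm_conj, Complex.norm_real, Real.norm_of_nonneg hR.le,
    div_self hR.ne', one_mul]

/-- Replacing the zeros `a i` of `f` by their reflections does not increase the bound for `f` on
the disc. -/
theorem norm_reflected_le {ι : Type*} [Fintype ι] {a : ι → ℂ} {f g : ℂ → ℂ} {R M : ℝ}
    (hR : 0 < R) (hg : DiffContOnCl ℂ g (ball 0 R))
    (hfg : ∀ z ∈ closedBall (0 : ℂ) R, f z = (∏ i, (z - a i)) * g z)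
    (hM : ∀ z ∈ sphere (0 : ℂ) R, ‖f z‖ ≤ M) {z : ℂ} (hz : z ∈ closedBall (0 : ℂ) R) :
    ‖(∏ i, ((R : ℂ) - (starRingEnd ℂ (a i) / R) * z)) * g z‖ ≤ M := by
  have hd : DiffContOnCl ℂ (fun z => (∏ i, ((R : ℂ) - (starRingEnd ℂ (a i) / R) * z)) * g z)
      (ball 0 R) := by
    have : Differentiable ℂ (fun z : ℂ => ∏ i, ((R : ℂ) - (starRingEnd ℂ (a i) / R) * z)) := by
      fun_prop
    exact this.diffContOnCl.smul hg
  refine Complex.norm_le_of_forall_mem_frontier_norm_le isBounded_ball hd (fun w hw => ?_)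
    (by rwa [closure_ball _ hR.ne'])
  rw [frontier_ball _ hR.ne'] at hw
  refine le_trans (le_of_eq ?_) (hM w hw)
  rw [hfg w (sphere_subset_closedBall hw), norm_mul, norm_mul, norm_prod, norm_prod]
  congr 1
  exact Finset.prod_congr rfl fun i _ => norm_reflected_sub hR (by simpa using hw)

/-- Jensen-type bound for the number of zeros. -/
theorem card_zeros_le {ι : Type*} [Fintype ι] {a : ι → ℂ} {f g : ℂ → ℂ} {A : ℝ}
    (hg : DifferentiableOn ℂ g (ball 0 2)) (ha : ∀ i, ‖a i‖ ≤ 7 / 4)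
    (hfg : ∀ z ∈ ball (0 : ℂ) 2, f z = (∏ i, (z - a i)) * g z) (h0 : f 0 ≠ 0)
    (hA : ∀ z ∈ sphere (0 : ℂ) (15 / 8), ‖f z‖ ≤ Real.exp A * ‖f 0‖) :
    (Fintype.card ι : ℝ) ≤ 15 * A := by
  have hsub : closedBall (0 : ℂ) (15 / 8) ⊆ ball 0 2 := closedBall_subset_ball (by norm_num)
  have hG := norm_reflected_le (a := a) (z := 0) (by norm_num : (0 : ℝ) < 15 / 8)
    (hg.diffContOnCl_ball hsub) (fun z hz => hfg z (hsub hz)) hA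
    (mem_closedBall_self (by norm_num))
  have hg0 : ‖f 0‖ ≤ (7 / 4) ^ Fintype.card ι * ‖g 0‖ := by
    rw [hfg 0 (by simp), norm_mul, norm_prod]
    gcongr
    rw [← Finset.card_univ, ← Finset.prod_const]
    exact Finset.prod_le_prod (fun i _ => norm_nonneg _) fun i _ => by simpa using ha i
  have h0' : 0 < ‖f 0‖ := norm_pos_iff.2 h0
  have hG' : (15 / 8 : ℝ) ^ Fintype.card ι * ‖g 0‖ ≤ Real.exp A * ‖f 0‖ := by
    simpa [norm_mul, norm_prod, abs_of_pos, div_pow] using hG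
  have hpow : (15 / 14 : ℝ) ^ Fintype.card ι ≤ Real.exp A := by
    have h1 : (15 / 14 : ℝ) ^ Fintype.card ι * ‖f 0‖ ≤ Real.exp A * ‖f 0‖ := by
      calc (15 / 14 : ℝ) ^ Fintype.card ι * ‖f 0‖
          ≤ (15 / 14 : ℝ) ^ Fintype.card ι * ((7 / 4) ^ Fintype.card ι * ‖g 0‖) := by gcongr
        _ = (15 / 8 : ℝ) ^ Fintype.card ι * ‖g 0‖ := by
          rw [← mul_assoc, ← mul_pow]; norm_num
        _ ≤ _ := hG'
    exact le_of_mul_le_mul_right h1 h0'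
  have hlog := Real.log_le_log (by positivity) hpow
  rw [Real.log_exp, Real.log_pow] at hlog
  have h15 : (1 / 15 : ℝ) ≤ Real.log (15 / 14) := by
    have := Real.one_sub_inv_le_log_of_pos (by norm_num : (0 : ℝ) < 15 / 14)
    norm_num at this ⊢
    linarith
  have : (Fintype.card ι : ℝ) * (1 / 15) ≤ Fintype.card ι * Real.log (15 / 14) := by gcongr
  linarith

/-- All zeros of `f` in a disc can be factored out, the zero `a₀` with prescribed multiplicity. -/
theorem exists_factorization {f : ℂ → ℂ} {A : ℝ} (hf : DifferentiableOn ℂ f (ball 0 2))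
    (h0 : f 0 ≠ 0) (hA : ∀ z ∈ sphere (0 : ℂ) (15 / 8), ‖f z‖ ≤ Real.exp A * ‖f 0‖)
    {a₀ : ℂ} (ha₀ : ‖a₀‖ ≤ 7 / 4) {m : ℕ} (hm : (m : ℕ∞) ≤ analyticOrderAt f a₀) :
    ∃ (k : ℕ) (b : Fin k → ℂ) (g : ℂ → ℂ), (∀ j, ‖b j‖ ≤ 7 / 4) ∧
      DifferentiableOn ℂ g (ball 0 2) ∧ (∀ z, f z = (z - a₀) ^ m * ((∏ j, (z - b j)) * g z)) ∧
      ∀ z ∈ closedBall (0 : ℂ) (7 / 4), g z ≠ 0 := by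
  let P : ℕ → Prop := fun k => ∃ (b : Fin k → ℂ) (g : ℂ → ℂ), (∀ j, ‖b j‖ ≤ 7 / 4) ∧
      DifferentiableOn ℂ g (ball 0 2) ∧ (∀ z, f z = (z - a₀) ^ m * ((∏ j, (z - b j)) * g z))
  have hsub : closedBall (0 : ℂ) (7 / 4) ⊆ ball 0 2 := closedBall_subset_ball (by norm_num)
  have hP0 : P 0 := by
    obtain ⟨g, hg, hfg⟩ := exists_eq_sub_pow_mul_of_le_analyticOrderAt isOpen_ball
      (hsub (by simpa using ha₀)) m hf hm
    exact ⟨Fin.elim0, g, fun j => j.elim0, hg, fun z => by simp [hfg z]⟩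
  have hbound : ∀ k, P k → (k : ℝ) ≤ 15 * A := by
    rintro k ⟨b, g, hb, hg, hfg⟩
    have := card_zeros_le (ι := Fin m ⊕ Fin k) (a := Sum.elim (fun _ => a₀) b) hg
      (by rintro (i | j) <;> simp [ha₀, hb])
      (fun z _ => by rw [hfg z, Fintype.prod_sum_type]; simp [mul_assoc]) h0 hA
    simp only [Fintype.card_sum, Fintype.card_fin, Nat.cast_add] at this
    have hm0 : (0 : ℝ) ≤ m := by positivity
    linarith
  obtain ⟨k, hk, hk'⟩ : ∃ k, P k ∧ ¬ P (k + 1) := by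
    by_contra! hcon
    obtain ⟨n, hn⟩ := exists_nat_gt (15 * A)
    have hall : ∀ n, P n := fun n => Nat.rec hP0 hcon n
    exact absurd (hbound n (hall n)) (not_le.2 hn)
  obtain ⟨b, g, hb, hg, hfg⟩ := hk
  refine ⟨k, b, g, hb, hg, hfg, fun z hz hgz => hk' ?_⟩
  obtain ⟨q, hq, hgq⟩ := exists_eq_sub_mul_of_eq_zero isOpen_ball hg (hsub hz) hgz
  refine ⟨Fin.cons z b, q, Fin.cases (by simpa using hz) (by simpa using hb), hq, fun w => ?_⟩
  rw [hfg, hgq, Fin.prod_univ_succ]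
  simp only [Fin.cons_zero, Fin.cons_succ]
  ring

/-- Borel–Carathéodory bound for the logarithmic derivative of a zero-free function. -/
theorem norm_logDeriv_le_of_ne_zero {G : ℂ → ℂ} {A : ℝ} (hA : 0 < A)
    (hG : DifferentiableOn ℂ G (ball 0 (7 / 4))) (hG0 : ∀ z ∈ ball (0 : ℂ) (7 / 4), G z ≠ 0)
    (hGA : ∀ z ∈ ball (0 : ℂ) (7 / 4), ‖G z‖ ≤ Real.exp A * ‖G 0‖) {z : ℂ} (hz : ‖z‖ ≤ 13 / 8) :
    ‖logDeriv G z‖ ≤ 864 * A := by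
  have hz0 : (0 : ℂ) ∈ ball (0 : ℂ) (7 / 4) := mem_ball_self (by norm_num)
  have hlog : DifferentiableOn ℂ (logDeriv G) (ball 0 (7 / 4)) :=
    (hG.deriv isOpen_ball).div hG hG0
  obtain ⟨F₀, hF₀⟩ := hlog.isExactOn_ball
  set F : ℂ → ℂ := fun z => F₀ z - F₀ 0 with hFdef
  have hF : ∀ z ∈ ball (0 : ℂ) (7 / 4), HasDerivAt F (logDeriv G z) z := fun z hz =>
    (hF₀ z hz).sub_const _
  have hFd : DifferentiableOn ℂ F (ball 0 (7 / 4)) := fun z hz =>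
    (hF z hz).differentiableAt.differentiableWithinAt
  have hF0 : F 0 = 0 := by simp [hFdef]
  have hderiv : ∀ z ∈ ball (0 : ℂ) (7 / 4), HasDerivAt (fun w => exp (-F w) * G w) 0 z := by
    intro z hz
    have h := ((hF z hz).neg.cexp).mul (hG.differentiableAt (isOpen_ball.mem_nhds hz)).hasDerivAt
    refine h.congr_deriv ?_
    have := hG0 z hz
    rw [logDeriv_apply]
    field_simp
    ring
  have hconst : ∀ z ∈ ball (0 : ℂ) (7 / 4), exp (-F z) * G z = G 0 := by
    intro z hz
    have := (convex_ball (0 : ℂ) (7 / 4)).is_const_of_fderivWithin_eq_zero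
      (𝕜 := ℂ) (f := fun w => exp (-F w) * G w)
      (fun w hw => (hderiv w hw).differentiableAt.differentiableWithinAt)
      (fun w hw => by
        rw [fderivWithin_of_isOpen isOpen_ball hw]
        have := (hderiv w hw).hasFDerivAt.fderiv
        rw [this]; ext; simp) hz hz0
    simpa [hF0] using this
  have hre : Set.MapsTo F (ball 0 (7 / 4)) {z | z.re ≤ A} := by
    intro z hz
    have h1 := hGA z hz
    rw [← hconst z hz, norm_mul, norm_exp, neg_re, ← mul_assoc, ← Real.exp_add] at h1
    have h2 : 1 * ‖G z‖ ≤ Real.exp (A + -(F z).re) * ‖G z‖ := by rwa [one_mul]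
    have h3 := le_of_mul_le_mul_right h2 (norm_pos_iff.2 (hG0 z hz))
    have h4 := Real.one_le_exp_iff.1 h3
    simp only [Set.mem_ofPred_eq]
    linarith
  have hFle : ∀ w : ℂ, ‖w‖ ≤ 27 / 16 → ‖F w‖ ≤ 54 * A := by
    intro w hw
    have h := borelCaratheodory_zero hA hFd hre (by norm_num)
      (mem_ball_zero_iff.2 (by linarith : ‖w‖ < 7 / 4)) hF0
    refine h.trans ?_
    rw [div_le_iff₀ (by linarith)]
    nlinarith
  have hzb : z ∈ ball (0 : ℂ) (7 / 4) := mem_ball_zero_iff.2 (by linarith)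
  have hsub : closedBall z (1 / 16) ⊆ ball (0 : ℂ) (7 / 4) := fun w hw => by
    have h1 : ‖w - z‖ ≤ 1 / 16 := by simpa [dist_eq_norm] using hw
    have := norm_le_norm_add_norm_sub' w z
    exact mem_ball_zero_iff.2 (by linarith)
  have hcauchy := norm_deriv_le_of_forall_mem_sphere_norm_le (c := z) (C := 54 * A)
    (by norm_num : (0 : ℝ) < 1 / 16) (hFd.diffContOnCl_ball hsub) (fun w hw => by
      have h1 : ‖w - z‖ = 1 / 16 := by simpa [dist_eq_norm] using hw
      have := norm_le_norm_add_norm_sub' w z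
      exact hFle w (by linarith))
  rw [(hF z hzb).deriv] at hcauchy
  linarith

/-- Landau's local formula: the logarithmic derivative is a sum over the nearby zeros up to a
controlled holomorphic error. -/
theorem exists_logDeriv_eq_sum_add {ι : Type*} [Fintype ι] {a : ι → ℂ} {f g : ℂ → ℂ} {A : ℝ}
    (hA0 : 0 < A) (hg : DifferentiableOn ℂ g (ball 0 2)) (ha : ∀ i, ‖a i‖ ≤ 7 / 4)
    (hfg : ∀ z, f z = (∏ i, (z - a i)) * g z)
    (hA : ∀ z ∈ sphere (0 : ℂ) (15 / 8), ‖f z‖ ≤ Real.exp A * ‖f 0‖)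
    (hg0 : ∀ z ∈ closedBall (0 : ℂ) (7 / 4), g z ≠ 0) (hcard : (Fintype.card ι : ℝ) ≤ 15 * A) :
    ∃ h : ℂ → ℂ, DifferentiableOn ℂ h (ball 0 (7 / 4)) ∧
      (∀ z, ‖z‖ ≤ 13 / 8 → ‖h z‖ ≤ 909 * A) ∧
      ∀ z ∈ ball (0 : ℂ) (7 / 4), f z ≠ 0 → logDeriv f z = ∑ i, (z - a i)⁻¹ + h z := by
  have hsub : closedBall (0 : ℂ) (15 / 8) ⊆ ball 0 2 := closedBall_subset_ball (by norm_num)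
  have hsub' : ball (0 : ℂ) (7 / 4) ⊆ ball 0 2 := ball_subset_ball (by norm_num)
  set c : ι → ℂ := fun i => starRingEnd ℂ (a i) / (15 / 8 : ℝ) with hc
  set R : ℂ := ((15 / 8 : ℝ) : ℂ) with hR
  have hRn : ‖R‖ = 15 / 8 := by rw [hR, norm_real]; norm_num
  have hcn : ∀ i, ‖c i‖ ≤ 14 / 15 := fun i => by
    have h1 : ‖c i‖ = ‖a i‖ / (15 / 8) := by
      rw [hc]; simp only [norm_div, norm_conj, hRn]
    rw [h1, div_le_iff₀ (by norm_num)]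
    linarith [ha i]
  have hden : ∀ i (z : ℂ), ‖z‖ ≤ 7 / 4 → 15 / 8 - 14 / 15 * ‖z‖ ≤ ‖R - c i * z‖ := fun i z hz => by
    have h1 := norm_sub_norm_le R (c i * z)
    rw [hRn, norm_mul] at h1
    have h2 : ‖c i‖ * ‖z‖ ≤ 14 / 15 * ‖z‖ := by gcongr; exact hcn i
    linarith
  have hne : ∀ i, ∀ z ∈ ball (0 : ℂ) (7 / 4), R - c i * z ≠ 0 := fun i z hz => by
    have hz' : ‖z‖ < 7 / 4 := mem_ball_zero_iff.1 hz
    have := hden i z hz'.le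
    exact norm_pos_iff.1 (by linarith)
  set G : ℂ → ℂ := fun z => (∏ i, (R - c i * z)) * g z with hGdef
  have hprod : Differentiable ℂ (fun z : ℂ => ∏ i, (R - c i * z)) := by fun_prop
  have hgd : DifferentiableOn ℂ g (ball 0 (7 / 4)) := hg.mono hsub'
  have hGd : DifferentiableOn ℂ G (ball 0 (7 / 4)) := hprod.differentiableOn.mul hgd
  have hgne : ∀ z ∈ ball (0 : ℂ) (7 / 4), g z ≠ 0 := fun z hz => hg0 z (ball_subset_closedBall hz)
  have hGne : ∀ z ∈ ball (0 : ℂ) (7 / 4), G z ≠ 0 := fun z hz =>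
    mul_ne_zero (Finset.prod_ne_zero_iff.2 fun i _ => hne i z hz) (hgne z hz)
  have hG0 : ‖f 0‖ ≤ ‖G 0‖ := by
    rw [hfg 0, hGdef]
    simp only [norm_mul, norm_prod]
    gcongr with i
    simp only [mul_zero, sub_zero, zero_sub, norm_neg, hRn]
    linarith [ha i]
  have hGA : ∀ z ∈ ball (0 : ℂ) (7 / 4), ‖G z‖ ≤ Real.exp A * ‖G 0‖ := fun z hz =>
    (norm_reflected_le (a := a) (by norm_num : (0 : ℝ) < 15 / 8) (hg.diffContOnCl_ball hsub)
      (fun z _ => hfg z) hA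
      (closedBall_subset_closedBall (by norm_num) (ball_subset_closedBall hz))).trans (by gcongr)
  refine ⟨fun z => logDeriv G z + ∑ i, c i / (R - c i * z), ?_, fun z hz => ?_, fun z hz hfz => ?_⟩
  · refine ((hGd.deriv isOpen_ball).div hGd hGne).add (DifferentiableOn.fun_sum fun i _ => ?_)
    exact (differentiableOn_const _).div (by fun_prop) (hne i)
  · have h1 := norm_logDeriv_le_of_ne_zero hA0 hGd hGne hGA hz
    have h2 : ‖∑ i, c i / (R - c i * z)‖ ≤ Fintype.card ι * 3 := by
      rw [← Finset.card_univ, ← nsmul_eq_mul]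
      refine (norm_sum_le _ _).trans (Finset.sum_le_card_nsmul _ _ _ fun i _ => ?_)
      have h3 := hden i z (by linarith)
      rw [norm_div, div_le_iff₀ (by linarith)]
      linarith [hcn i]
    refine (norm_add_le _ _).trans ?_
    linarith
  · have hfz' := hfz
    rw [hfg z, mul_ne_zero_iff, Finset.prod_ne_zero_iff] at hfz'
    have hgdz : DifferentiableAt ℂ g z := hgd.differentiableAt (isOpen_ball.mem_nhds hz)
    have e1 : logDeriv f z = ∑ i, (z - a i)⁻¹ + logDeriv g z := by
      rw [show f = fun z => (∏ i, (z - a i)) * g z from funext hfg,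
        logDeriv_mul z (Finset.prod_ne_zero_iff.2 hfz'.1) hfz'.2 (by fun_prop) hgdz,
        logDeriv_prod hfz'.1 (fun i _ => by fun_prop)]
      congr 1
      exact Finset.sum_congr rfl fun i _ => by simp [logDeriv_apply]
    have e2 : logDeriv G z = -∑ i, c i / (R - c i * z) + logDeriv g z := by
      rw [hGdef, logDeriv_mul z (Finset.prod_ne_zero_iff.2 fun i _ => hne i z hz) hfz'.2
        (by fun_prop) hgdz, logDeriv_prod (fun i _ => hne i z hz) (fun i _ => by fun_prop),
        ← Finset.sum_neg_distrib]
      congr 1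
      exact Finset.sum_congr rfl fun i _ => by simp [logDeriv_apply, neg_div]
    simp only [e1, e2]
    ring

theorem iteratedDeriv_inv_sub_const_zero (n : ℕ) (a : ℂ) :
    iteratedDeriv n (fun z : ℂ => (z - a)⁻¹) 0 = -((n.factorial : ℂ) * a⁻¹ ^ (n + 1)) := by
  have h := congrFun (iter_deriv_inv_linear_sub (𝕜 := ℂ) n 1 a) 0
  simp only [one_mul, one_pow, mul_one, zero_sub] at h
  rw [iteratedDeriv_eq_iterate, h, show (-1 - (n : ℤ)) = -((n + 1 : ℕ) : ℤ) by push_cast; ring,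
    zpow_neg, zpow_natCast, neg_pow a, mul_inv, inv_pow, ← inv_pow (-1 : ℂ), inv_neg_one, pow_succ]
  have : ((-1 : ℂ) ^ n) * (-1) ^ n = 1 := by rw [← mul_pow]; simp
  linear_combination (-(n.factorial : ℂ) * (a ^ (n + 1))⁻¹) * this

/-- Cauchy's estimates bound the power sums of the reciprocals of the poles of `L`. -/
theorem norm_sum_inv_pow_le {ι : Type*} [Fintype ι] {a : ι → ℂ} {L h : ℂ → ℂ} {r R B D : ℝ}
    (hr : 0 < r) (hR : 0 < R) (ha : ∀ i, a i ≠ 0) (hL : DiffContOnCl ℂ L (ball 0 r))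
    (hh : DiffContOnCl ℂ h (ball 0 R)) (hLB : ∀ z ∈ sphere (0 : ℂ) r, ‖L z‖ ≤ B)
    (hhD : ∀ z ∈ sphere (0 : ℂ) R, ‖h z‖ ≤ D)
    (heq : L =ᶠ[𝓝 0] fun z => ∑ i, (z - a i)⁻¹ + h z) (n : ℕ) :
    ‖∑ i, (a i)⁻¹ ^ (n + 1)‖ ≤ B / r ^ n + D / R ^ n := by
  have hsm : ∀ i ∈ Finset.univ, ContDiffAt ℂ n (fun z => (z - a i)⁻¹) 0 := fun i _ =>
    ContDiffAt.inv (by fun_prop) (by simpa using ha i)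
  have hhs : ContDiffAt ℂ n h 0 :=
    ((hh.differentiableOn.analyticAt (ball_mem_nhds 0 hR)).contDiffAt).of_le le_top
  have e1 : iteratedDeriv n L 0 =
      -((n.factorial : ℂ) * ∑ i, (a i)⁻¹ ^ (n + 1)) + iteratedDeriv n h 0 := by
    rw [heq.iteratedDeriv_eq, iteratedDeriv_fun_add (ContDiffAt.sum hsm) hhs,
      iteratedDeriv_fun_sum hsm]
    simp only [iteratedDeriv_inv_sub_const_zero, Finset.sum_neg_distrib, Finset.mul_sum]
  have e2 : (n.factorial : ℂ) * ∑ i, (a i)⁻¹ ^ (n + 1)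
      = iteratedDeriv n h 0 - iteratedDeriv n L 0 := by rw [e1]; ring
  have h1 := norm_iteratedDeriv_le_of_forall_mem_sphere_norm_le n hr hL hLB
  have h2 := norm_iteratedDeriv_le_of_forall_mem_sphere_norm_le n hR hh hhD
  have h3 : (n.factorial : ℝ) * ‖∑ i, (a i)⁻¹ ^ (n + 1)‖ ≤
      n.factorial * (B / r ^ n + D / R ^ n) := by
    calc (n.factorial : ℝ) * ‖∑ i, (a i)⁻¹ ^ (n + 1)‖
        = ‖iteratedDeriv n h 0 - iteratedDeriv n L 0‖ := by rw [← e2, norm_mul]; simp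
      _ ≤ n.factorial * D / R ^ n + n.factorial * B / r ^ n :=
        (norm_sub_le _ _).trans (add_le_add h2 h1)
      _ = _ := by ring
  exact le_of_mul_le_mul_left h3 (by exact_mod_cast n.factorial_pos)

/-- If all zeros of `f` near `0` have norm at least `3 / 2`, then the multiplicity of a zero at
`-3 / 2` is controlled by bounds for `f` and for its logarithmic derivative. -/
theorem multiplicity_mul_le {f : ℂ → ℂ} {A B : ℝ} (hA0 : 0 < A) (hB0 : 0 ≤ B)
    (hf : DifferentiableOn ℂ f (ball 0 2))
    (hA : ∀ z ∈ sphere (0 : ℂ) (15 / 8), ‖f z‖ ≤ Real.exp A * ‖f 0‖)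
    (hB : ∀ z ∈ sphere (0 : ℂ) (1 / 2), ‖logDeriv f z‖ ≤ B)
    (hzero : ∀ z : ℂ, ‖z‖ ≤ 7 / 4 → f z = 0 → 3 / 2 ≤ ‖z‖)
    {m : ℕ} (hm : (m : ℕ∞) ≤ analyticOrderAt f (-(3 / 2))) {N : ℕ} (hN : 0 < N) :
    (m : ℝ) * N ≤ 35466 * A + 3 * (B * 3 ^ N) := by
  have hnorm : ‖(-(3 / 2) : ℂ)‖ = 3 / 2 := by norm_num
  have hne : ∀ z : ℂ, ‖z‖ < 3 / 2 → f z ≠ 0 := fun z hz h =>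
    absurd (hzero z (by linarith) h) (not_le.2 hz)
  have h0 : f 0 ≠ 0 := hne 0 (by norm_num)
  obtain ⟨k, b, g, hb, hg, hfg, hg0⟩ :=
    exists_factorization hf h0 hA (by rw [hnorm]; norm_num) hm
  set a : Fin m ⊕ Fin k → ℂ := Sum.elim (fun _ => -(3 / 2)) b with hadef
  have ha : ∀ i, ‖a i‖ ≤ 7 / 4 := by
    rintro (i | j)
    · rw [hadef, Sum.elim_inl, hnorm]; norm_num
    · exact hb j
  have hfa : ∀ z, f z = (∏ i, (z - a i)) * g z := fun z => by
    rw [hfg z, Fintype.prod_sum_type]; simp [hadef, mul_assoc]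
  have ha' : ∀ i, 3 / 2 ≤ ‖a i‖ := fun i => hzero _ (ha i) (by
    rw [hfa, Finset.prod_eq_zero (Finset.mem_univ i) (sub_self _), zero_mul])
  have hane : ∀ i, a i ≠ 0 := fun i => norm_pos_iff.1 (by linarith [ha' i])
  have hcard := card_zeros_le hg ha (fun z _ => hfa z) h0 hA
  obtain ⟨h, hhd, hhb, hheq⟩ := exists_logDeriv_eq_sum_add hA0 hg ha hfa hA hg0 hcard
  have hfd : DifferentiableOn ℂ f (ball 0 (3 / 2)) := hf.mono (ball_subset_ball (by norm_num))
  have hLd : DifferentiableOn ℂ (logDeriv f) (ball 0 (3 / 2)) :=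
    (hfd.deriv isOpen_ball).div hfd fun z hz => hne z (mem_ball_zero_iff.1 hz)
  have hpow := norm_sum_inv_pow_le (by norm_num) (by norm_num) hane
    (hLd.diffContOnCl_ball (closedBall_subset_ball (by norm_num : (1 / 2 : ℝ) < 3 / 2)))
    (hhd.diffContOnCl_ball (closedBall_subset_ball (by norm_num : (13 / 8 : ℝ) < 7 / 4))) hB
    (fun z hz => hhb z (mem_sphere_zero_iff_norm.1 hz).le) (by
      filter_upwards [ball_mem_nhds (0 : ℂ) (by norm_num : (0 : ℝ) < 3 / 2)] with z hz
      exact hheq z (ball_subset_ball (by norm_num) hz) (hne z (mem_ball_zero_iff.1 hz)))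
  have hv : ∀ n : ℕ, ‖∑ i, (-(3 / 2) * (a i)⁻¹) ^ (n + 1)‖ ≤
      3 / 2 * (B * 3 ^ n + 909 * A * (12 / 13) ^ n) := fun n => by
    simp only [mul_pow]
    rw [← Finset.mul_sum, norm_mul, norm_pow, hnorm]
    calc (3 / 2 : ℝ) ^ (n + 1) * ‖∑ i, (a i)⁻¹ ^ (n + 1)‖
        ≤ (3 / 2) ^ (n + 1) * (B / (1 / 2) ^ n + 909 * A / (13 / 8) ^ n) := by
          gcongr; exact hpow n
      _ = 3 / 2 * (B * ((3 / 2) ^ n / (1 / 2) ^ n) + 909 * A * ((3 / 2) ^ n / (13 / 8) ^ n)) := by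
          ring
      _ = _ := by rw [← div_pow, ← div_pow]; norm_num
  have key := card_mul_le_of_power_sums (v := fun i => -(3 / 2) * (a i)⁻¹)
    (fun i => by simp only [hadef, Sum.elim_inl]; norm_num)
    (fun j => by
      rw [norm_mul, norm_inv, hnorm, ← div_eq_mul_inv, div_le_one (by linarith [ha' (Sum.inr j)])]
      exact ha' _) hN
  rw [Fintype.card_fin] at key
  have hgeom3 : ∑ n ∈ Finset.range N, (3 : ℝ) ^ n ≤ 3 ^ N := by
    rw [geom_sum_eq (by norm_num)]
    have : (0 : ℝ) < 3 ^ N := by positivity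
    linarith
  have hgeom : ∑ n ∈ Finset.range N, (12 / 13 : ℝ) ^ n ≤ 13 := by
    rw [geom_sum_eq (by norm_num)]
    have : (0 : ℝ) < (12 / 13) ^ N := by positivity
    rw [div_le_iff_of_neg (by norm_num)]
    linarith
  have hsum : ∑ n ∈ Finset.range N, ‖∑ i, (-(3 / 2) * (a i)⁻¹) ^ (n + 1)‖ ≤
      3 / 2 * (B * 3 ^ N + 909 * A * 13) := by
    refine (Finset.sum_le_sum fun n _ => hv n).trans ?_
    rw [← Finset.mul_sum, Finset.sum_add_distrib, ← Finset.mul_sum, ← Finset.mul_sum]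
    gcongr
  linarith

/-- An L-series is bounded on every closed half-plane of absolute convergence. -/
theorem norm_LSeries_le_tsum_norm_term {f : ℕ → ℂ} {s s' : ℂ} (hs : LSeriesSummable f s)
    (h : s.re ≤ s'.re) : ‖LSeries f s'‖ ≤ ∑' n, ‖LSeries.term f s n‖ :=
  tsum_of_norm_bounded hs.norm.hasSum (LSeries.norm_term_le_of_re_le_re f h)

theorem exists_one_le_mul_norm_riemannZeta :
    ∃ K : ℝ, 1 ≤ K ∧ ∀ s : ℂ, 2 ≤ s.re → 1 ≤ K * ‖riemannZeta s‖ := by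
  have h2 : (1 : ℝ) < (2 : ℂ).re := by norm_num
  refine ⟨max 1 (∑' n, ‖LSeries.term (fun n => (ArithmeticFunction.moebius n : ℂ)) 2 n‖),
    le_max_left _ _, fun s hs => ?_⟩
  have hs1 : 1 < s.re := by linarith
  have h := ArithmeticFunction.LSeries_zeta_mul_Lseries_moebius hs1
  rw [ArithmeticFunction.LSeries_zeta_eq_riemannZeta hs1] at h
  have hle := norm_LSeries_le_tsum_norm_term (s' := s)
    (ArithmeticFunction.LSeriesSummable_moebius_iff.2 h2) (by simpa using hs)
  calc (1 : ℝ) = ‖LSeries (fun n => (ArithmeticFunction.moebius n : ℂ)) s‖ * ‖riemannZeta s‖ := by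
        rw [← norm_mul, mul_comm, h, norm_one]
    _ ≤ _ := by
        gcongr
        exact hle.trans (le_max_right _ _)

theorem exists_norm_logDeriv_riemannZeta_le :
    ∃ B : ℝ, 0 ≤ B ∧ ∀ s : ℂ, 3 / 2 ≤ s.re → ‖logDeriv riemannZeta s‖ ≤ B := by
  have h2 : (1 : ℝ) < (3 / 2 : ℂ).re := by norm_num
  refine ⟨∑' n, ‖LSeries.term (fun n => (ArithmeticFunction.vonMangoldt n : ℂ)) (3 / 2) n‖,
    tsum_nonneg fun n => norm_nonneg _, fun s hs => ?_⟩
  have hle := norm_LSeries_le_tsum_norm_term (s' := s)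
    (ArithmeticFunction.LSeriesSummable_vonMangoldt h2) (by norm_num; exact hs)
  rwa [ArithmeticFunction.LSeries_vonMangoldt_eq_deriv_riemannZeta_div (by linarith), neg_div,
    norm_neg] at hle

/-- Assume the Riemann hypothesis.  Then there is a constant `C > 0` such that every
nontrivial zero `ρ` of the Riemann zeta function with `Im ρ ≥ 16` has order of vanishing
`m(ρ) ≤ C · log (Im ρ) / log log (Im ρ)`.  The order of vanishing being at most `B` is
expressed by: whenever all iterated derivatives of `ζ` at `ρ` of order `< m` vanish, then
`m ≤ B`. -/
theorem zeta_zero_multiplicity_le_log_div_loglog_of_RH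
    (RH : ∀ ρ : ℂ, riemannZeta ρ = 0 → 0 < ρ.re → ρ.re < 1 → ρ.re = 1 / 2) :
    ∃ C : ℝ, 0 < C ∧ ∀ ρ : ℂ, riemannZeta ρ = 0 → 0 < ρ.re → ρ.re < 1 → 16 ≤ ρ.im →
      ∀ m : ℕ, (∀ k < m, iteratedDeriv k riemannZeta ρ = 0) →
        (m : ℝ) ≤ C * Real.log ρ.im / Real.log (Real.log ρ.im) := by
  obtain ⟨C, hC0, hC⟩ := exists_norm_riemannZeta_le (by norm_num : (0 : ℝ) < 1 / 8)
  obtain ⟨K, hK1, hK⟩ := exists_one_le_mul_norm_riemannZeta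
  obtain ⟨B, hB0, hB⟩ := exists_norm_logDeriv_riemannZeta_le
  set M : ℝ := (1 + 2 * C) * K with hM
  have hM1 : 1 ≤ M := by nlinarith
  have hlogM : 0 ≤ Real.log M := Real.log_nonneg hM1
  refine ⟨2 * (35466 * (1 + Real.log M) + 9 * B), by positivity, fun ρ hρ hρ0 hρ1 hγ m hm => ?_⟩
  have hρre := RH ρ hρ hρ0 hρ1
  set γ : ℝ := ρ.im with hγdef
  have hl : 1 < Real.log γ := by
    rw [Real.lt_log_iff_exp_lt (by linarith)]
    linarith [Real.exp_one_lt_d9]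
  have hL : 0 < Real.log (Real.log γ) := Real.log_pos hl
  set s₀ : ℂ := ⟨2, γ⟩ with hs₀
  have hre : ∀ z : ℂ, (s₀ + z).re = 2 + z.re := fun z => by simp [hs₀]
  have him : ∀ z : ℂ, (s₀ + z).im = γ + z.im := fun z => by simp [hs₀]
  have hone : ∀ z : ℂ, ‖z‖ ≤ 2 → 1 ≤ ‖s₀ + z - 1‖ := fun z hz => by
    have h1 := (abs_le.1 (abs_im_le_norm z)).1
    have h2 := (le_abs_self _).trans (abs_im_le_norm (s₀ + z - 1))
    rw [sub_im, him, one_im] at h2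
    linarith
  set f : ℂ → ℂ := fun z => riemannZeta (s₀ + z) with hfdef
  have hdiff : ∀ z : ℂ, ‖z‖ ≤ 2 → DifferentiableAt ℂ f z := fun z hz => by
    have h1 : DifferentiableAt ℂ riemannZeta (s₀ + z) := differentiableAt_riemannZeta fun h => by
      have := hone z hz
      norm_num [h] at this
    exact h1.comp z (by fun_prop)
  have hfd : DifferentiableOn ℂ f (ball 0 2) := fun z hz =>
    (hdiff z (mem_ball_zero_iff.1 hz).le).differentiableWithinAt
  have hA : ∀ z ∈ sphere (0 : ℂ) (15 / 8),
      ‖f z‖ ≤ Real.exp (Real.log γ + Real.log M) * ‖f 0‖ := fun z hz => by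
    rw [mem_sphere_zero_iff_norm] at hz
    rw [Real.exp_add, Real.exp_log (by linarith), Real.exp_log (by linarith)]
    have h1 := (abs_le.1 (abs_re_le_norm z)).1
    have h2 := hC (s₀ + z) (by rw [hre]; linarith) (hone z (by linarith))
    have h3 : ‖s₀ + z‖ ≤ 2 * γ := by
      have h4 := norm_le_abs_re_add_abs_im s₀
      rw [show s₀.re = 2 from rfl, show s₀.im = γ from rfl, abs_of_pos (by linarith : 0 < γ),
        abs_two] at h4
      linarith [norm_add_le s₀ z]
    have h5 := hK (s₀ + 0) (by rw [hre]; simp)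
    calc ‖f z‖ ≤ 1 + C * ‖s₀ + z‖ := h2
      _ ≤ 1 + C * (2 * γ) := by gcongr
      _ ≤ (1 + 2 * C) * γ * 1 := by linarith
      _ ≤ (1 + 2 * C) * γ * (K * ‖f 0‖) := by gcongr
      _ = _ := by rw [hM]; ring
  have hBf : ∀ z ∈ sphere (0 : ℂ) (1 / 2), ‖logDeriv f z‖ ≤ B := fun z hz => by
    rw [mem_sphere_zero_iff_norm] at hz
    have h1 := (abs_le.1 (abs_re_le_norm z)).1
    have h2 := hB (s₀ + z) (by rw [hre]; linarith)
    rwa [logDeriv_apply, hfdef, deriv_comp_const_add, ← logDeriv_apply]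
  have hzero : ∀ z : ℂ, ‖z‖ ≤ 7 / 4 → f z = 0 → 3 / 2 ≤ ‖z‖ := fun z hz hfz => by
    have h1 := (abs_le.1 (abs_re_le_norm z)).1
    have h2 : (s₀ + z).re < 1 := by
      by_contra! h
      exact riemannZeta_ne_zero_of_one_le_re h hfz
    have h3 := RH _ hfz (by rw [hre]; linarith) h2
    rw [hre] at h3
    linarith
  have hρs : s₀ + -(3 / 2) = ρ := by
    apply Complex.ext
    · rw [hre, hρre]; norm_num
    · rw [him]; norm_num [hγdef]
  have hord : (m : ℕ∞) ≤ analyticOrderAt f (-(3 / 2)) := by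
    rw [natCast_le_analyticOrderAt_iff_iteratedDeriv_eq_zero
      (hfd.analyticAt (isOpen_ball.mem_nhds (by norm_num)))]
    intro k hk
    rw [hfdef, iteratedDeriv_comp_const_add]
    simpa only [hρs] using hm k hk
  set N : ℕ := ⌊Real.log (Real.log γ) / 2⌋₊ + 1 with hN
  have key := multiplicity_mul_le (by linarith) hB0 hfd hA hBf hzero hord (N := N) (Nat.succ_pos _)
  have hNle : Real.log (Real.log γ) / 2 ≤ N := by
    rw [hN]; push_cast; exact (Nat.lt_floor_add_one _).le
  have h3N : (3 : ℝ) ^ N ≤ 3 * Real.log γ := by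
    rw [hN, pow_succ, mul_comm]
    gcongr
    have h3 : (3 : ℝ) ≤ Real.exp 2 := by linarith [Real.add_one_le_exp 2]
    calc (3 : ℝ) ^ ⌊Real.log (Real.log γ) / 2⌋₊
        ≤ Real.exp 2 ^ ⌊Real.log (Real.log γ) / 2⌋₊ := by gcongr
      _ = Real.exp (⌊Real.log (Real.log γ) / 2⌋₊ * 2) := (Real.exp_nat_mul _ _).symm
      _ ≤ Real.exp (Real.log (Real.log γ)) := by
        gcongr
        linarith [Nat.floor_le (half_pos hL).le]
      _ = Real.log γ := Real.exp_log (by linarith)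
  rw [le_div_iff₀ hL]
  have h1 : (m : ℝ) * (Real.log (Real.log γ) / 2) ≤ m * N := by gcongr
  have h2 : B * 3 ^ N ≤ B * (3 * Real.log γ) := by gcongr
  have h3 : Real.log M ≤ Real.log M * Real.log γ := le_mul_of_one_le_right hlogM hl.le
  linarith
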